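/- arXiv:2311.06599 — 3 statements merged into one kernel-verified Lean document; each statement's English description precedes it below -/
import Mathlib

section
/- Let q ≥ 3 be an odd integer and l₁, α ∈ ℝ with l₁ ≠ 0 and α ≠ 0. Consider the truncated polar system ṙ = 2α r^q sin(2qψ), ψ̇ = μ + l₁ r + α r^{q−1} cos(2qψ). There exist μ₀ > 0, r₀ > 0, and C > 0 such that for every real μ with 0 < |μ| < μ₀ the following hold: (i) if μ·l₁ > 0, the system has no equilibrium (r,ψ) with 0 < r < r₀; (ii) if μ·l₁ < 0, then (r,ψ) with 0 < r < r₀ is an equilibrium if and only if sin(2qψ) = 0 and μ + l₁r + α r^{q−1} cos(2qψ) = 0; moreover, for every integer k there is a unique r_k ∈ (0, r₀) such that (r_k, kπ/(2q)) is an equilibrium, and |r_k − (−μ/l₁)| ≤ C|μ|^{q−1}. Hence for μ·l₁ < 0 the equilibria with 0 < r < r₀ form a garland of 4q points (ψ taken modulo 2π) lying near the circle r = −μ/l₁ and equidistant from each other at the angle π/(2q). -/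
/-- On `[0, R]` with `R ≤ 1`, the power map `x ↦ x ^ n`, `n ≥ 2`, is `n R`-Lipschitz. -/
lemma pow_sub_pow_le_of_le_one {n : ℕ} (hn : 2 ≤ n) {R r s : ℝ} (hR : R ≤ 1) (hs : 0 ≤ s)
    (hsr : s ≤ r) (hr : r ≤ R) : r ^ n - s ^ n ≤ n * R * (r - s) := by
  induction n, hn using Nat.le_induction with
  | base => push_cast; nlinarith
  | succ n hn ih =>
    have hsn : s ^ n ≤ s := pow_le_of_le_one hs (by linarith) (by omega)
    have hmono : s ^ n ≤ r ^ n := pow_le_pow_left₀ hs hsr n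
    have h₁ : r * (r ^ n - s ^ n) ≤ r ^ n - s ^ n :=
      mul_le_of_le_one_left (by linarith) (by linarith)
    have h₂ : s ^ n * (r - s) ≤ R * (r - s) :=
      mul_le_mul_of_nonneg_right (by linarith) (by linarith)
    push_cast
    linear_combination h₁ + h₂ + ih

lemma half_sub_le_add_mul_pow_sub {n : ℕ} (hn : 2 ≤ n) {B β R r s : ℝ} (hβ : |β| ≤ B)
    (hR : R ≤ 1) (hBR : n * B * R ≤ 1 / 2) (hs : 0 ≤ s) (hsr : s ≤ r) (hr : r ≤ R) :
    (r - s) / 2 ≤ (r + β * r ^ n) - (s + β * s ^ n) := by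
  have hB : 0 ≤ B := (abs_nonneg β).trans hβ
  have hmono : s ^ n ≤ r ^ n := pow_le_pow_left₀ hs hsr n
  have h₁ : -B * (r ^ n - s ^ n) ≤ β * (r ^ n - s ^ n) :=
    mul_le_mul_of_nonneg_right (abs_le.1 hβ).1 (by linarith)
  have h₂ := mul_le_mul_of_nonneg_left (pow_sub_pow_le_of_le_one hn hR hs hsr hr) hB
  have h₃ := mul_le_mul_of_nonneg_right hBR (sub_nonneg.2 hsr)
  linear_combination h₁ + h₂ + h₃

/-- The small positive root of `r + β r ^ n = m` for small `m > 0`. -/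
lemma exists_root_add_mul_pow {n : ℕ} (hn : 2 ≤ n) {B β R m : ℝ} (hβ : |β| ≤ B)
    (hR0 : 0 < R) (hR : R ≤ 1) (hBR : n * B * R ≤ 1 / 2) (hm : 0 < m) (hmR : m < R / 2) :
    ∃ r, (0 < r ∧ r < R ∧ r + β * r ^ n = m) ∧
      (∀ s, 0 < s → s < R → s + β * s ^ n = m → s = r) ∧ |r - m| ≤ B * (2 * m) ^ n := by
  have hn0 : n ≠ 0 := by omega
  have h0 : (0 : ℝ) + β * 0 ^ n = 0 := by simp [hn0]
  have hmonoR := half_sub_le_add_mul_pow_sub hn hβ hR hBR le_rfl hR0.le le_rfl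
  obtain ⟨r, ⟨hr0, hrR⟩, hr⟩ := intermediate_value_Ioo (f := fun r : ℝ => r + β * r ^ n) hR0.le
    (by fun_prop) (show m ∈ Set.Ioo _ _ from ⟨by simpa [hn0] using hm, by linarith⟩)
  replace hr : r + β * r ^ n = m := hr
  refine ⟨r, ⟨hr0, hrR, hr⟩, fun s hs0 hsR hs => ?_, ?_⟩
  · rcases le_total s r with h | h
    · linarith [half_sub_le_add_mul_pow_sub hn hβ hR hBR hs0.le h hrR.le]
    · linarith [half_sub_le_add_mul_pow_sub hn hβ hR hBR hr0.le h hsR.le]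
  · have hr2 : r ≤ 2 * m := by
      linarith [half_sub_le_add_mul_pow_sub hn hβ hR hBR le_rfl hr0.le hrR.le]
    rw [← hr, sub_add_cancel_left, abs_neg, abs_mul, abs_of_pos (pow_pos hr0 n), hr]
    exact mul_le_mul hβ (pow_le_pow_left₀ hr0.le hr2 n) (by positivity) ((abs_nonneg β).trans hβ)

/-- for the truncated polar system
`ṙ = 2α r^q sin(2qψ)`, `ψ̇ = μ + l₁ r + α r^(q−1) cos(2qψ)` with `l₁ ≠ 0`,
`α ≠ 0`, there exist `μ₀, r₀, C > 0` such that for `0 < |μ| < μ₀`: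
(i) if `μ l₁ > 0` there are no equilibria with `0 < r < r₀`;
(ii) if `μ l₁ < 0`, equilibria with `0 < r < r₀` are characterized by
`sin(2qψ) = 0` together with the second equation, and for every integer `k`
there is a unique `r_k ∈ (0, r₀)` with `(r_k, kπ/(2q))` an equilibrium,
satisfying `|r_k − (−μ/l₁)| ≤ C |μ|^(q−1)`. -/
theorem stmt11 (q : ℕ) (hq : Odd q) (hq3 : 3 ≤ q) (l₁ α : ℝ)
    (hl : l₁ ≠ 0) (hα : α ≠ 0) :
    ∃ μ₀ > (0 : ℝ), ∃ r₀ > (0 : ℝ), ∃ C > (0 : ℝ),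
      ∀ μ : ℝ, 0 < |μ| → |μ| < μ₀ →
        (0 < μ * l₁ →
          ¬ ∃ r ψ : ℝ, 0 < r ∧ r < r₀ ∧
            2 * α * r ^ q * Real.sin (2 * q * ψ) = 0 ∧
            μ + l₁ * r + α * r ^ (q - 1) * Real.cos (2 * q * ψ) = 0) ∧
        (μ * l₁ < 0 →
          (∀ r ψ : ℝ, 0 < r → r < r₀ →
            ((2 * α * r ^ q * Real.sin (2 * q * ψ) = 0 ∧
              μ + l₁ * r + α * r ^ (q - 1) * Real.cos (2 * q * ψ) = 0) ↔
             (Real.sin (2 * q * ψ) = 0 ∧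
              μ + l₁ * r + α * r ^ (q - 1) * Real.cos (2 * q * ψ) = 0))) ∧
          (∀ k : ℤ, ∃ rk : ℝ,
            (0 < rk ∧ rk < r₀ ∧
              2 * α * rk ^ q * Real.sin (2 * q * ((k : ℝ) * Real.pi / (2 * q))) = 0 ∧
              μ + l₁ * rk +
                α * rk ^ (q - 1) * Real.cos (2 * q * ((k : ℝ) * Real.pi / (2 * q))) = 0) ∧
            (∀ r' : ℝ, 0 < r' → r' < r₀ →
              2 * α * r' ^ q * Real.sin (2 * q * ((k : ℝ) * Real.pi / (2 * q))) = 0 →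
              μ + l₁ * r' +
                α * r' ^ (q - 1) * Real.cos (2 * q * ((k : ℝ) * Real.pi / (2 * q))) = 0 →
              r' = rk) ∧
            |rk - (-μ / l₁)| ≤ C * |μ| ^ (q - 1))) := by
  have hn : 2 ≤ q - 1 := by omega
  generalize q - 1 = n at hn
  have hq0 : (2 * q : ℝ) ≠ 0 := by positivity
  set B : ℝ := |α / l₁|
  have hB0 : 0 < B := abs_pos.2 (div_ne_zero hα hl)
  have hl0 : 0 < |l₁| := abs_pos.2 hl
  have hD : 0 < 2 * n * B + 1 := by positivity
  obtain ⟨R, hR⟩ : ∃ R : ℝ, R = 1 / (2 * n * B + 1) := ⟨_, rfl⟩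
  have hR0 : 0 < R := by rw [hR]; positivity
  have hDR : (2 * n * B + 1) * R = 1 := by rw [hR]; field_simp
  have hBR : n * B * R ≤ 1 / 2 := by linarith
  have hR1 : R ≤ 1 := by
    have : 0 ≤ n * B * R := by positivity
    linarith
  have hβ (x : ℝ) : |α / l₁ * Real.cos x| ≤ B := by
    rw [abs_mul]
    exact mul_le_of_le_one_right hB0.le (Real.abs_cos_le_one x)
  have key (μ r x : ℝ) : μ + l₁ * r + α * r ^ n * Real.cos x = 0 ↔
      r + α / l₁ * Real.cos x * r ^ n = -μ / l₁ := by
    rw [eq_div_iff hl]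
    field_simp
    constructor <;> intro h <;> linear_combination h
  have hdiv (μ : ℝ) : -μ / l₁ = -(μ * l₁) / l₁ ^ 2 := by field_simp
  refine ⟨|l₁| * R / 2, by positivity, R, hR0, B * (2 / |l₁|) ^ n, by positivity,
    fun μ _ hμ => ⟨?_, fun hneg => ⟨fun r ψ hr _ => ?_, fun k => ?_⟩⟩⟩
  · rintro hpos ⟨r, ψ, hr0, hrR, -, h⟩
    rw [key] at h
    have h₁ := half_sub_le_add_mul_pow_sub hn (hβ (2 * q * ψ)) hR1 hBR le_rfl hr0.le hrR.le
    rw [h, zero_pow (by omega)] at h₁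
    have h₂ : -μ / l₁ < 0 := by
      rw [hdiv]
      exact div_neg_of_neg_of_pos (by linarith) (by positivity)
    linarith
  · simp [hα, hr.ne']
  · have hm : 0 < -μ / l₁ := by
      rw [hdiv]
      exact div_pos (by linarith) (by positivity)
    have hmabs : -μ / l₁ = |μ| / |l₁| := by
      rw [← abs_of_pos hm, abs_div, abs_neg]
    have hmR : -μ / l₁ < R / 2 := by
      rw [hmabs, div_lt_iff₀ hl0]
      linarith
    rw [mul_div_cancel₀ _ hq0, Real.sin_int_mul_pi]
    simp only [key, mul_zero, true_and, forall_const]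
    obtain ⟨r, hr, huniq, hbound⟩ :=
      exists_root_add_mul_pow hn (hβ (k * Real.pi)) hR0 hR1 hBR hm hmR
    refine ⟨r, hr, huniq, hbound.trans_eq ?_⟩
    rw [hmabs, mul_assoc, ← mul_pow]
    congr 2
    ring
end

section
/- Let q ≥ 3 be an odd integer, μ₁, μ₂, A, B, α ∈ ℝ, and let Φ : ℝ → ℝ be differentiable. Define F(z) = iμ₁z + iΦ(|z|²)z + iμ₂(z̄)^{q−1} + iAμ₂ z^{q+1} + iBμ₂ z(z̄)^q + iα(z̄)^{2q−1}, where z̄ denotes the complex conjugate of z, and the planar vector field V(x,y) = (Re F(x+iy), Im F(x+iy)). Then the divergence of V satisfies, for all z = x+iy: ∂V₁/∂x (x,y) + ∂V₂/∂y (x,y) = −2μ₂((q+1)A − B)·Im(z^q). In particular, V is divergence-free everywhere if and only if μ₂((q+1)A − B) = 0. -/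
/-- The derivative of the normal form along a differentiable curve `c`: the first summand collects
the terms in `v = c'(t)`, the second the terms in its conjugate, and the last one the variation of
`Φ (normSq c)`. -/
theorem hasDerivAt_normalForm_comp (q : ℕ) (μ₁ μ₂ A B α : ℝ)
    {Φ : ℝ → ℝ} (hΦ : Differentiable ℝ Φ) {c : ℝ → ℂ} {v : ℂ} {t : ℝ} (hc : HasDerivAt c v t) :
    HasDerivAt (fun s : ℝ => Complex.I * (μ₁ : ℂ) * c s +
      Complex.I * ((Φ (Complex.normSq (c s)) : ℝ) : ℂ) * c s +
      Complex.I * (μ₂ : ℂ) * ((starRingEnd ℂ) (c s)) ^ (q - 1) +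
      Complex.I * (A : ℂ) * (μ₂ : ℂ) * c s ^ (q + 1) +
      Complex.I * (B : ℂ) * (μ₂ : ℂ) * c s * ((starRingEnd ℂ) (c s)) ^ q +
      Complex.I * (α : ℂ) * ((starRingEnd ℂ) (c s)) ^ (2 * q - 1))
    (Complex.I * ((μ₁ + Φ (Complex.normSq (c t)) : ℝ) + A * μ₂ * (q + 1) * c t ^ q +
        B * μ₂ * (starRingEnd ℂ) (c t ^ q)) * v +
      Complex.I * (μ₂ * ((q - 1 : ℕ) : ℂ) * (starRingEnd ℂ) (c t) ^ (q - 1 - 1) +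
        B * μ₂ * q * c t * (starRingEnd ℂ) (c t) ^ (q - 1) +
        α * ((2 * q - 1 : ℕ) : ℂ) * (starRingEnd ℂ) (c t) ^ (2 * q - 1 - 1)) *
          (starRingEnd ℂ) v +
      Complex.I * ((deriv Φ (Complex.normSq (c t)) *
        (2 * ((c t).re * v.re + (c t).im * v.im)) : ℝ) : ℂ) * c t) t := by
  have hre : HasDerivAt (fun s => (c s).re) v.re t :=
    Complex.reCLM.hasFDerivAt.comp_hasDerivAt t hc
  have him : HasDerivAt (fun s => (c s).im) v.im t :=
    Complex.imCLM.hasFDerivAt.comp_hasDerivAt t hc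
  have hconj : HasDerivAt (fun s => (starRingEnd ℂ) (c s)) ((starRingEnd ℂ) v) t :=
    Complex.conjCLE.toContinuousLinearMap.hasFDerivAt.comp_hasDerivAt t hc
  have hnorm : HasDerivAt (fun s => Complex.normSq (c s))
      (2 * ((c t).re * v.re + (c t).im * v.im)) t := by
    simp only [Complex.normSq_apply]
    exact ((hre.mul hre).add (him.mul him)).congr_deriv (by ring)
  have hΦc : HasDerivAt (fun s => ((Φ (Complex.normSq (c s)) : ℝ) : ℂ))
      ((deriv Φ (Complex.normSq (c t)) * (2 * ((c t).re * v.re + (c t).im * v.im)) : ℝ) : ℂ) t :=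
    ((hΦ (Complex.normSq (c t))).hasDerivAt.comp t hnorm).ofReal_comp
  refine ((((((hc.const_mul (Complex.I * (μ₁ : ℂ))).add
    ((hΦc.const_mul Complex.I).mul hc)).add
    ((hconj.pow (q - 1)).const_mul (Complex.I * (μ₂ : ℂ)))).add
    ((hc.pow (q + 1)).const_mul (Complex.I * (A : ℂ) * (μ₂ : ℂ)))).add
    ((hc.const_mul (Complex.I * (B : ℂ) * (μ₂ : ℂ))).mul (hconj.pow q))).add
    ((hconj.pow (2 * q - 1)).const_mul (Complex.I * (α : ℂ)))).congr_deriv ?_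
  simp only [Pi.pow_apply, map_pow, Nat.add_sub_cancel]
  push_cast
  ring

/-- the divergence of the planar vector field associated with the
reversible non-conservative normal form
`F z = iμ₁z + iΦ(|z|²)z + iμ₂ z̄^(q−1) + iAμ₂ z^(q+1) + iBμ₂ z z̄^q + iα z̄^(2q−1)`
equals `−2μ₂((q+1)A − B) Im(z^q)`; in particular the field is divergence-free
everywhere iff `μ₂((q+1)A − B) = 0`. -/
theorem stmt17 (q : ℕ) (hq : Odd q) (hq3 : 3 ≤ q) (μ₁ μ₂ A B α : ℝ)
    (Φ : ℝ → ℝ) (hΦ : Differentiable ℝ Φ)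
    (F : ℂ → ℂ)
    (hF : ∀ z : ℂ, F z = Complex.I * (μ₁ : ℂ) * z +
      Complex.I * ((Φ (Complex.normSq z) : ℝ) : ℂ) * z +
      Complex.I * (μ₂ : ℂ) * ((starRingEnd ℂ) z) ^ (q - 1) +
      Complex.I * (A : ℂ) * (μ₂ : ℂ) * z ^ (q + 1) +
      Complex.I * (B : ℂ) * (μ₂ : ℂ) * z * ((starRingEnd ℂ) z) ^ q +
      Complex.I * (α : ℂ) * ((starRingEnd ℂ) z) ^ (2 * q - 1)) :
    (∀ x y : ℝ,
      deriv (fun x' : ℝ => (F ((x' : ℂ) + (y : ℂ) * Complex.I)).re) x +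
        deriv (fun y' : ℝ => (F ((x : ℂ) + (y' : ℂ) * Complex.I)).im) y =
      -2 * μ₂ * (((q : ℝ) + 1) * A - B) * (((x : ℂ) + (y : ℂ) * Complex.I) ^ q).im) ∧
    ((∀ x y : ℝ,
      deriv (fun x' : ℝ => (F ((x' : ℂ) + (y : ℂ) * Complex.I)).re) x +
        deriv (fun y' : ℝ => (F ((x : ℂ) + (y' : ℂ) * Complex.I)).im) y = 0) ↔
      μ₂ * (((q : ℝ) + 1) * A - B) = 0) := by
  have hdiv : ∀ x y : ℝ,
      deriv (fun x' : ℝ => (F ((x' : ℂ) + (y : ℂ) * Complex.I)).re) x +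
        deriv (fun y' : ℝ => (F ((x : ℂ) + (y' : ℂ) * Complex.I)).im) y =
      -2 * μ₂ * (((q : ℝ) + 1) * A - B) *
        (((x : ℂ) + (y : ℂ) * Complex.I) ^ q).im := by
    intro x y
    have hx : HasDerivAt (fun s : ℝ => (s : ℂ) + (y : ℂ) * Complex.I) 1 x :=
      (hasDerivAt_id x).ofReal_comp.add_const _
    have hy : HasDerivAt (fun s : ℝ => (x : ℂ) + (s : ℂ) * Complex.I) Complex.I y := by
      simpa using ((hasDerivAt_id y).ofReal_comp.mul_const Complex.I).const_add (x : ℂ)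
    have hX := Complex.reCLM.hasFDerivAt.comp_hasDerivAt x
      (hasDerivAt_normalForm_comp q μ₁ μ₂ A B α hΦ hx)
    have hY := Complex.imCLM.hasFDerivAt.comp_hasDerivAt y
      (hasDerivAt_normalForm_comp q μ₁ μ₂ A B α hΦ hy)
    simp only [hF]
    refine (congrArg₂ (· + ·) hX.deriv hY.deriv).trans ?_
    have hzre : ((x : ℂ) + (y : ℂ) * Complex.I).re = x := by simp
    have hzim : ((x : ℂ) + (y : ℂ) * Complex.I).im = y := by simp
    generalize (x : ℂ) + (y : ℂ) * Complex.I = z at *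
    generalize (μ₂ * ((q - 1 : ℕ) : ℂ) * (starRingEnd ℂ) z ^ (q - 1 - 1) +
        B * μ₂ * q * z * (starRingEnd ℂ) z ^ (q - 1) +
        α * ((2 * q - 1 : ℕ) : ℂ) * (starRingEnd ℂ) z ^ (2 * q - 1 - 1)) = w
    generalize z ^ q = p
    generalize deriv Φ (Complex.normSq z) = d
    generalize Φ (Complex.normSq z) = e
    simp [hzre, hzim]
    ring
  refine ⟨hdiv, fun h => ?_, fun h x y => ?_⟩
  · obtain ⟨z, hz⟩ := IsAlgClosed.exists_pow_nat_eq Complex.I (show 0 < q by omega)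
    have h0 := (hdiv z.re z.im).symm.trans (h z.re z.im)
    rw [Complex.re_add_im, hz, Complex.I_im] at h0
    linarith
  · rw [hdiv]
    linear_combination (-2 * (((x : ℂ) + (y : ℂ) * Complex.I) ^ q).im) * h
end

section
/- Let q ≥ 3 be an odd integer, μ₁, μ₂, A, B, α ∈ ℝ, and let Φ : ℝ → ℝ be differentiable. Define F(z) = iμ₁z + iΦ(|z|²)z + iμ₂(z̄)^{q−1} + iAμ₂ z^{q+1} + iBμ₂ z(z̄)^q + iα(z̄)^{2q−1} and V(x,y) = (Re F(x+iy), Im F(x+iy)). If z = x + iy satisfies (z̄)^q = z^q (equivalently Im(z^q) = 0, i.e. z lies on one of the fixed-point lines of the reversing involutions z ↦ e^{2ikπ/q} z̄), then the divergence of V vanishes at (x,y): ∂V₁/∂x (x,y) + ∂V₂/∂y (x,y) = 0. In particular, reversibly symmetric equilibria of the truncated reversible non-conservative normal form are conservative (have zero divergence). -/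
/-- The divergence of the planar field of `F` is twice the real part of `∂F/∂z = a`, where `a` and
`b = ∂F/∂z̄` are given through the derivatives of `F` along curves. -/
theorem divergence_eq_two_mul_re_wirtinger {F : ℂ → ℂ} {a b : ℂ} (x y : ℝ)
    (h : ∀ (γ : ℝ → ℂ) (v : ℂ) (t : ℝ), HasDerivAt γ v t → γ t = x + y * Complex.I →
      HasDerivAt (fun s => F (γ s)) (a * v + b * (starRingEnd ℂ) v) t) :
    deriv (fun x' : ℝ => (F ((x' : ℂ) + (y : ℂ) * Complex.I)).re) x +
      deriv (fun y' : ℝ => (F ((x : ℂ) + (y' : ℂ) * Complex.I)).im) y = 2 * a.re := by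
  have hx : HasDerivAt (fun x' : ℝ => (x' : ℂ) + (y : ℂ) * Complex.I) 1 x := by
    simpa using (Complex.ofRealCLM.hasDerivAt (x := x)).add_const ((y : ℂ) * Complex.I)
  have hy : HasDerivAt (fun y' : ℝ => (x : ℂ) + (y' : ℂ) * Complex.I) Complex.I y := by
    simpa using ((Complex.ofRealCLM.hasDerivAt (x := y)).mul_const Complex.I).const_add (x : ℂ)
  have hre := Complex.reCLM.hasFDerivAt.comp_hasDerivAt x (h _ _ _ hx rfl)
  have him := Complex.imCLM.hasFDerivAt.comp_hasDerivAt y (h _ _ _ hy rfl)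
  have ere : deriv (fun x' : ℝ => (F ((x' : ℂ) + (y : ℂ) * Complex.I)).re) x = _ := hre.deriv
  have eim : deriv (fun y' : ℝ => (F ((x : ℂ) + (y' : ℂ) * Complex.I)).im) y = _ := him.deriv
  rw [ere, eim]
  simp
  ring

theorem hasDerivAt_conj_comp {γ : ℝ → ℂ} {v : ℂ} {t : ℝ} (h : HasDerivAt γ v t) :
    HasDerivAt (fun s => (starRingEnd ℂ) (γ s)) ((starRingEnd ℂ) v) t :=
  h.star

theorem hasDerivAt_ofReal_comp_normSq {Φ : ℝ → ℝ} (hΦ : Differentiable ℝ Φ) {γ : ℝ → ℂ} {v : ℂ}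
    {t : ℝ} (h : HasDerivAt γ v t) :
    HasDerivAt (fun s => ((Φ (Complex.normSq (γ s)) : ℝ) : ℂ))
      (((deriv Φ (Complex.normSq (γ t)) : ℝ) : ℂ) *
        ((starRingEnd ℂ) (γ t) * v + γ t * (starRingEnd ℂ) v)) t := by
  have hre : HasDerivAt (fun s => (γ s).re) v.re t :=
    Complex.reCLM.hasFDerivAt.comp_hasDerivAt t h
  have him : HasDerivAt (fun s => (γ s).im) v.im t :=
    Complex.imCLM.hasFDerivAt.comp_hasDerivAt t h
  have hN : HasDerivAt (fun s => Complex.normSq (γ s))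
      (v.re * (γ t).re + (γ t).re * v.re + (v.im * (γ t).im + (γ t).im * v.im)) t := by
    simpa only [Complex.normSq_apply] using (hre.fun_mul hre).fun_add (him.fun_mul him)
  have hc : HasDerivAt (fun s => Φ (Complex.normSq (γ s))) _ t :=
    (hΦ _).hasDerivAt.comp t hN
  refine hc.ofReal_comp.congr_deriv ?_
  apply Complex.ext <;>
    simp only [Complex.ofReal_re, Complex.ofReal_im, Complex.mul_re, Complex.mul_im, Complex.add_re,
      Complex.add_im, Complex.conj_re, Complex.conj_im] <;> ring

/-- for the reversible non-conservative normal form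
`F z = iμ₁z + iΦ(|z|²)z + iμ₂ z̄^(q−1) + iAμ₂ z^(q+1) + iBμ₂ z z̄^q + iα z̄^(2q−1)`,
the divergence of the associated planar vector field vanishes at every point
`z = x + iy` with `z̄^q = z^q` (i.e. on the fixed-point lines of the reversing
involutions); in particular reversibly symmetric equilibria are conservative. -/
theorem stmt18 (q : ℕ) (hq : Odd q) (hq3 : 3 ≤ q) (μ₁ μ₂ A B α : ℝ)
    (Φ : ℝ → ℝ) (hΦ : Differentiable ℝ Φ)
    (F : ℂ → ℂ)
    (hF : ∀ z : ℂ, F z = Complex.I * (μ₁ : ℂ) * z +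
      Complex.I * ((Φ (Complex.normSq z) : ℝ) : ℂ) * z +
      Complex.I * (μ₂ : ℂ) * ((starRingEnd ℂ) z) ^ (q - 1) +
      Complex.I * (A : ℂ) * (μ₂ : ℂ) * z ^ (q + 1) +
      Complex.I * (B : ℂ) * (μ₂ : ℂ) * z * ((starRingEnd ℂ) z) ^ q +
      Complex.I * (α : ℂ) * ((starRingEnd ℂ) z) ^ (2 * q - 1)) :
    ∀ x y : ℝ,
      ((starRingEnd ℂ) ((x : ℂ) + (y : ℂ) * Complex.I)) ^ q =
        ((x : ℂ) + (y : ℂ) * Complex.I) ^ q →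
      deriv (fun x' : ℝ => (F ((x' : ℂ) + (y : ℂ) * Complex.I)).re) x +
        deriv (fun y' : ℝ => (F ((x : ℂ) + (y' : ℂ) * Complex.I)).im) y = 0 := by
  intro x y hxy
  set z : ℂ := (x : ℂ) + (y : ℂ) * Complex.I with hz
  have him : (z ^ q).im = 0 := by
    rw [← map_pow] at hxy
    exact Complex.conj_eq_iff_im.mp hxy
  have hF' : F = _ := funext hF
  rw [divergence_eq_two_mul_re_wirtinger
    (a := Complex.I * (μ₁ : ℂ) + Complex.I * (Φ (Complex.normSq z) : ℂ) +
      Complex.I * ((deriv Φ (Complex.normSq z) : ℝ) : ℂ) * ((starRingEnd ℂ) z * z) +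
      Complex.I * (A : ℂ) * (μ₂ : ℂ) * (((q + 1 : ℕ) : ℂ) * z ^ q) +
      Complex.I * (B : ℂ) * (μ₂ : ℂ) * ((starRingEnd ℂ) z) ^ q)
    (b := Complex.I * ((deriv Φ (Complex.normSq z) : ℝ) : ℂ) * z ^ 2 +
      Complex.I * (μ₂ : ℂ) * (((q - 1 : ℕ) : ℂ) * ((starRingEnd ℂ) z) ^ (q - 1 - 1)) +
      Complex.I * (B : ℂ) * (μ₂ : ℂ) * z * ((q : ℂ) * ((starRingEnd ℂ) z) ^ (q - 1)) +
      Complex.I * (α : ℂ) *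
        (((2 * q - 1 : ℕ) : ℂ) * ((starRingEnd ℂ) z) ^ (2 * q - 1 - 1)))]
  · have hzz : (starRingEnd ℂ) z * z = (Complex.normSq z : ℂ) := Complex.normSq_eq_conj_mul_self.symm
    have hre : z ^ q = ((z ^ q).re : ℂ) := Complex.ext (by simp) (by simp [him])
    rw [hxy, hre, hzz, ← Complex.ofReal_natCast]
    simp
  · intro γ v t hγ hγt
    rw [← hz] at hγt
    have hc := hasDerivAt_conj_comp hγ
    have h := (((((hγ.const_mul (Complex.I * (μ₁ : ℂ))).fun_add
      (((hasDerivAt_ofReal_comp_normSq hΦ hγ).const_mul Complex.I).fun_mul hγ)).fun_add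
      ((hc.fun_pow (q - 1)).const_mul (Complex.I * (μ₂ : ℂ)))).fun_add
      ((hγ.fun_pow (q + 1)).const_mul (Complex.I * (A : ℂ) * (μ₂ : ℂ)))).fun_add
      ((hγ.const_mul (Complex.I * (B : ℂ) * (μ₂ : ℂ))).fun_mul (hc.fun_pow q))).fun_add
      ((hc.fun_pow (2 * q - 1)).const_mul (Complex.I * (α : ℂ)))
    rw [hF']
    refine h.congr_deriv ?_
    rw [hγt, Nat.add_sub_cancel]
    ring
end
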